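/- arXiv:2507.17571 — 2 statements merged into one kernel-verified Lean document; each statement's English description precedes it below -/
import Mathlib

section
/- Characterization of Hamming (n,σ)-equivalence for skew polycyclic codes. Let n, m be positive integers, let i₀ < i₁ < ⋯ < i_{m−1} be natural numbers with i_{m−1} ≤ n−1, and let a = (a_{i₀},…,a_{i_{m−1}}) and b = (b_{i₀},…,b_{i_{m−1}}) be m-tuples of nonzero elements of 𝔽_q. Then the following are equivalent: (i) there exists a nonzero α ∈ 𝔽_q such that a_{i_j}·N_{n−i_j}^σ(σ^{i_j}(α)) = b_{i_j} for every j ∈ {0,…,m−1}; (ii) the m-tuple (a_{i₀}^{−1}b_{i₀}, …, a_{i_{m−1}}^{−1}b_{i_{m−1}}) belongs to the cyclic subgroup of (𝔽_q^*)^m generated by the m-tuple (N_{n−i₀}^σ(σ^{i₀}(ξ)), …, N_{n−i_{m−1}}^σ(σ^{i_{m−1}}(ξ))). -/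
/-- `sNorm σ i α = σ^{i-1}(α) ⋯ σ(α) · α`, the `i`-th skew norm of `α`. -/
def sNorm {F : Type*} [Field F] (σ : F ≃+* F) (i : ℕ) (α : F) : F :=
  ∏ j ∈ Finset.range i, (⇑σ)^[j] α

theorem sNorm_pow {F : Type*} [Field F] (σ : F ≃+* F) (i : ℕ) (α : F) (t : ℕ) :
    sNorm σ i (α ^ t) = sNorm σ i α ^ t := by
  simp only [sNorm, iterate_map_pow, Finset.prod_pow]

/-- Characterization of Hamming `(n,σ)`-equivalence for skew polycyclic codes. -/
theorem hamming_equiv_polycyclic_iff_mem_cyclic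
    (p s : ℕ) (hp : p.Prime) (hs : 1 ≤ s)
    (F : Type*) [Field F] [Fintype F] (hF : Fintype.card F = p ^ s)
    (σ : F ≃+* F)
    (ξ : F) (hξ0 : ξ ≠ 0) (hξ : ∀ x : F, x ≠ 0 → ∃ m : ℕ, x = ξ ^ m)
    (n m : ℕ) (hn : 0 < n) (hm : 0 < m)
    (idx : Fin m → ℕ) (hidx : StrictMono idx) (hidxn : ∀ j, idx j ≤ n - 1)
    (a b : Fin m → F) (ha : ∀ j, a j ≠ 0) (hb : ∀ j, b j ≠ 0) :
    (∃ α : F, α ≠ 0 ∧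
        ∀ j : Fin m, a j * sNorm σ (n - idx j) ((⇑σ)^[idx j] α) = b j) ↔
    (∃ t : ℕ, ∀ j : Fin m,
        (a j)⁻¹ * b j = (sNorm σ (n - idx j) ((⇑σ)^[idx j] ξ)) ^ t) := by
  have key : ∀ (t : ℕ) (j : Fin m), sNorm σ (n - idx j) ((⇑σ)^[idx j] (ξ ^ t)) =
      sNorm σ (n - idx j) ((⇑σ)^[idx j] ξ) ^ t := fun t j => by
    rw [iterate_map_pow, sNorm_pow]
  constructor
  · rintro ⟨α, hα, h⟩
    obtain ⟨t, rfl⟩ := hξ α hα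
    exact ⟨t, fun j => by rw [← h j, key, inv_mul_cancel_left₀ (ha j)]⟩
  · rintro ⟨t, h⟩
    exact ⟨ξ ^ t, pow_ne_zero t hξ0, fun j => by rw [key, ← h j, mul_inv_cancel_left₀ (ha j)]⟩
end

section
/- Number of Hamming (n,σ)-equivalence classes for skew polycyclic codes. Let n, m be positive integers and let i₀ < i₁ < ⋯ < i_{m−1} be natural numbers with i_{m−1} ≤ n−1. The cyclic subgroup H of the direct product (𝔽_q^*)^m generated by the m-tuple (N_{n−i₀}^σ(σ^{i₀}(ξ)), …, N_{n−i_{m−1}}^σ(σ^{i_{m−1}}(ξ))) has index (q−1)^m / lcm_{j ∈ {0,…,m−1}}( (q−1)/gcd([n−i_j]_r, q−1) ) in (𝔽_q^*)^m. -/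
/-- `brk p r i = [i]_r = 1 + p^r + ⋯ + p^{r(i-1)} = (p^{ri} - 1)/(p^r - 1)`. -/
def brk (p r i : ℕ) : ℕ := ∑ j ∈ Finset.range i, p ^ (r * j)

/-- The order of a tuple is the least common multiple of the orders of its components. -/
theorem orderOf_pi_eq_lcm {ι G : Type*} [Fintype ι] [Monoid G] (u : ι → G) :
    orderOf u = Finset.univ.lcm fun j => orderOf (u j) := by
  refine Nat.dvd_antisymm ?_ ?_
  · rw [orderOf_dvd_iff_pow_eq_one]
    funext j
    exact orderOf_dvd_iff_pow_eq_one.mp (Finset.dvd_lcm (Finset.mem_univ j))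
  · refine Finset.lcm_dvd fun j _ => ?_
    rw [orderOf_dvd_iff_pow_eq_one]
    exact congrFun (pow_orderOf_eq_one u) j

/-- If `σ` is the `p ^ r`-power map, then the skew norm `N_i(a)` equals `a ^ [i]_r`. -/
theorem sNorm_eq_pow_brk {F : Type*} [Field F] {σ : F ≃+* F} {p r : ℕ}
    (hσ : ∀ a : F, σ a = a ^ p ^ r) (i : ℕ) (a : F) : sNorm σ i a = a ^ brk p r i := by
  have iterate_eq (j : ℕ) : (⇑σ)^[j] a = a ^ p ^ (r * j) := by
    induction j with
    | zero => simp
    | succ k ih =>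
      rw [Function.iterate_succ_apply', ih, hσ, ← pow_mul, ← pow_add, Nat.mul_succ]
  simp only [sNorm, brk, iterate_eq, Finset.prod_pow_eq_pow_sum]

/-- The order of the image of an element under an iterate of an automorphism. -/
theorem orderOf_iterate_ringEquiv {F : Type*} [Field F] (σ : F ≃+* F) (i : ℕ) (a : F) :
    orderOf ((⇑σ)^[i] a) = orderOf a := by
  induction i with
  | zero => rfl
  | succ k ih =>
    rw [Function.iterate_succ_apply', ← ih]
    exact orderOf_injective (σ : F →* F) σ.injective _

/-- A generator of the multiplicative group of a finite field has order `q - 1`. -/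
theorem orderOf_eq_card_sub_one_of_generator {F : Type*} [Field F] [Fintype F] {ξ : F}
    (hξ0 : ξ ≠ 0) (hξ : ∀ x : F, x ≠ 0 → ∃ k : ℕ, x = ξ ^ k) :
    orderOf ξ = Fintype.card F - 1 := by
  classical
  rw [← Fintype.card_units, ← Nat.card_eq_fintype_card]
  have h : orderOf (Units.mk0 ξ hξ0) = Nat.card Fˣ := by
    refine orderOf_eq_card_of_forall_mem_zpowers fun x => ?_
    obtain ⟨k, hk⟩ := hξ x x.ne_zero
    exact ⟨k, Units.ext (by simp [hk])⟩
  rw [← h, ← orderOf_units, Units.val_mk0]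

/-- Number of Hamming `(n,σ)`-equivalence classes for skew polycyclic codes:
the index in `(𝔽_q^*)^m` of the cyclic subgroup generated by the tuple
`(N_{n−i₀}^σ(σ^{i₀}(ξ)), …, N_{n−i_{m−1}}^σ(σ^{i_{m−1}}(ξ)))`. -/
theorem hamming_equiv_polycyclic_num_classes
    (p s r : ℕ) (hp : p.Prime) (hs : 1 ≤ s) (hr : r < s)
    (F : Type*) [Field F] [Fintype F] (hF : Fintype.card F = p ^ s)
    (σ : F ≃+* F) (hσ : ∀ a : F, σ a = a ^ p ^ r)
    (ξ : F) (hξ0 : ξ ≠ 0) (hξ : ∀ x : F, x ≠ 0 → ∃ m' : ℕ, x = ξ ^ m')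
    (n m : ℕ) (hn : 0 < n) (hm : 0 < m)
    (idx : Fin m → ℕ) (hidx : StrictMono idx) (hidxn : ∀ j, idx j ≤ n - 1)
    (u : Fin m → Fˣ)
    (hu : ∀ j : Fin m, (u j : F) = sNorm σ (n - idx j) ((⇑σ)^[idx j] ξ)) :
    (Subgroup.zpowers u).index =
      (p ^ s - 1) ^ m /
        Finset.univ.lcm (fun j : Fin m =>
          (p ^ s - 1) / Nat.gcd (brk p r (n - idx j)) (p ^ s - 1)) := by
  classical
  have hξ_ord : orderOf ξ = p ^ s - 1 := by
    rw [orderOf_eq_card_sub_one_of_generator hξ0 hξ, hF]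
  have hu_ord (j : Fin m) :
      orderOf (u j) = (p ^ s - 1) / Nat.gcd (brk p r (n - idx j)) (p ^ s - 1) := by
    have hfin : IsOfFinOrder ((⇑σ)^[idx j] ξ) := by
      rw [← orderOf_pos_iff, orderOf_iterate_ringEquiv, hξ_ord]
      exact Nat.sub_pos_of_lt (Nat.one_lt_pow (by omega) hp.one_lt)
    rw [← orderOf_units, hu, sNorm_eq_pow_brk hσ, hfin.orderOf_pow, orderOf_iterate_ringEquiv,
      hξ_ord, Nat.gcd_comm]
  have hcard : Nat.card (Fin m → Fˣ) = (p ^ s - 1) ^ m := by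
    rw [Nat.card_eq_fintype_card, Fintype.card_fun, Fintype.card_units, hF, Fintype.card_fin]
  simp only [← hu_ord]
  rw [← orderOf_pi_eq_lcm, ← hcard, ← (Subgroup.zpowers u).card_mul_index, Nat.card_zpowers,
    Nat.mul_div_cancel_left _ (orderOf_pos u)]
end
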